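/- Let I = [0,T] be a bounded time interval and H a separable Hilbert space. Let f : H → H be a bounded Lipschitz function, r > 0, and C ⊂ H a nonempty (r,f)-prox-regular set. Then for every u₀ ∈ C, the sweeping process u̇(t) + N(C,u(t)) ∋ f(u(t)), u(0) = u₀, has one and only one absolutely continuous solution u; it satisfies u(t) ∈ C for all t ∈ I and ‖u̇(t) − f(u(t))‖ ≤ ‖f‖_∞ for almost every t ∈ I. -/

import Mathlib

open MeasureTheory Set Filter Topology

noncomputable section

/-- The (set-valued) metric projection onto `C`:
`P_C(y) = {z ∈ C | ‖y - z‖ = d(y,C)}`. -/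
def projSet {E : Type*} [NormedAddCommGroup E] (C : Set E) (y : E) : Set E :=
  {z | z ∈ C ∧ ‖y - z‖ = Metric.infDist y C}

/-- The proximal normal cone of `C` at `x`:
`N(C,x) = {v | ∃ s > 0, x ∈ P_C(x + s v)}`. -/
def proxNormalCone {E : Type*} [NormedAddCommGroup E] [NormedSpace ℝ E]
    (C : Set E) (x : E) : Set E :=
  {v | ∃ s : ℝ, 0 < s ∧ x ∈ projSet C (x + s • v)}

/-- `Γ^r(C,x) = {v | x ∈ P_C(x + r v)}`, the good directions to project at scale `r`. -/
def gammaSet {E : Type*} [NormedAddCommGroup E] [NormedSpace ℝ E]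
    (r : ℝ) (C : Set E) (x : E) : Set E :=
  {v | x ∈ projSet C (x + r • v)}

/-- `C` is `(r,f)`-prox-regular (`r`-prox-regular in the direction `f`): for all `x ∈ C`
and `s ∈ (0,r)`, the projection `z` of `x + s f(x)/‖f(x)‖` onto `C` is well defined
(single valued), and the normalized vector from `z` to `x + s f(x)/‖f(x)‖` belongs to
`Γ^r(C,z)` (with the convention `v/‖v‖ = 0` when `v = 0`). -/
def DirProxRegular {E : Type*} [NormedAddCommGroup E] [NormedSpace ℝ E]
    (r : ℝ) (f : E → E) (C : Set E) : Prop :=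
  ∀ x ∈ C, ∀ s : ℝ, 0 < s → s < r →
    ∃ z : E, projSet C (x + (s * ‖f x‖⁻¹) • f x) = {z} ∧
      ‖x + (s * ‖f x‖⁻¹) • f x - z‖⁻¹ • (x + (s * ‖f x‖⁻¹) • f x - z) ∈ gammaSet r C z

/-- An absolutely continuous solution of the sweeping process
`u̇(t) + N(C(t),u(t)) ∋ f(u(t))`, `u(0) = u₀`, on `[0,T]`: `u` is absolutely continuous,
i.e. `u(t) = u₀ + ∫₀ᵗ g` for some Bochner-integrable density `g` (`g = u̇` a.e.),
`u(t) ∈ C(t)` for all `t ∈ [0,T]` and `f(u(t)) - u̇(t) ∈ N(C(t),u(t))` a.e. on `[0,T]`. -/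
def IsSweepingSol {E : Type*} [NormedAddCommGroup E] [NormedSpace ℝ E] [CompleteSpace E]
    (C : ℝ → Set E) (f : E → E) (T : ℝ) (u₀ : E) (u : ℝ → E) : Prop :=
  ∃ g : ℝ → E, IntegrableOn g (Set.Icc 0 T) ∧
    (∀ t ∈ Set.Icc (0:ℝ) T, u t = u₀ + ∫ s in (0:ℝ)..t, g s) ∧
    (∀ t ∈ Set.Icc (0:ℝ) T, u t ∈ C t) ∧
    (∀ᵐ t ∂volume.restrict (Set.Icc (0:ℝ) T),
      f (u t) - g t ∈ proxNormalCone (C t) (u t))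

section SweepingProcess

open scoped InnerProductSpace

variable {H : Type*} [NormedAddCommGroup H] [InnerProductSpace ℝ H]

lemma norm_sub_le_of_mem_projSet {E : Type*} [NormedAddCommGroup E] {C : Set E} {x y z : E}
    (h : z ∈ projSet C x) (hy : y ∈ C) :
    ‖x - z‖ ≤ ‖x - y‖ := by
  rw [h.2, ← dist_eq_norm]
  exact Metric.infDist_le_dist_of_mem hy

/-- Variational form of the membership `v ∈ Γ^r(C,x)`. -/
lemma inner_le_of_mem_gammaSet {r : ℝ} (hr : 0 < r) {C : Set H} {x v : H}
    (h : v ∈ gammaSet r C x) {y : H} (hy : y ∈ C) :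
    ⟪v, y - x⟫_ℝ ≤ (2 * r)⁻¹ * ‖y - x‖ ^ 2 := by
  have h1 := norm_sub_le_of_mem_projSet h hy
  have e : x + r • v - y = r • v - (y - x) := by abel
  rw [add_sub_cancel_left, e] at h1
  have h2 := pow_le_pow_left₀ (norm_nonneg _) h1 2
  rw [norm_sub_sq_real (r • v), real_inner_smul_left] at h2
  rw [inv_mul_eq_div, le_div_iff₀ (by positivity)]
  linarith

lemma mem_proxNormalCone_of_inner_le {c : ℝ} (hc : 0 < c) {C : Set H} {x v : H} (hx : x ∈ C)
    (h : ∀ y ∈ C, ⟪v, y - x⟫_ℝ ≤ c * ‖y - x‖ ^ 2) : v ∈ proxNormalCone C x := by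
  refine ⟨(2 * c)⁻¹, by positivity, hx, le_antisymm ?_ ?_⟩
  · refine (Metric.le_infDist ⟨x, hx⟩).2 fun y hy => ?_
    rw [dist_eq_norm]
    refine le_of_sq_le_sq ?_ (norm_nonneg _)
    have e : x + (2 * c)⁻¹ • v - y = (2 * c)⁻¹ • v - (y - x) := by abel
    rw [add_sub_cancel_left, e, norm_sub_sq_real ((2 * c)⁻¹ • v), real_inner_smul_left]
    have := mul_le_mul_of_nonneg_left (h y hy) (inv_nonneg.2 (by positivity : 0 ≤ 2 * c))
    have e2 : (2 * c)⁻¹ * (c * ‖y - x‖ ^ 2) = ‖y - x‖ ^ 2 / 2 := by field_simp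
    linarith
  · rw [← dist_eq_norm]
    exact Metric.infDist_le_dist_of_mem hx

/-- One projection step of length `h` from `x ∈ C`. -/
lemma DirProxRegular.exists_step {r : ℝ} (hr : 0 < r) {f : H → H} {C : Set H}
    (hC : DirProxRegular r f C) {x : H} (hx : x ∈ C) {h : ℝ} (hh : 0 < h) (hfr : h * ‖f x‖ < r) :
    ∃ z ∈ C, (∀ y ∈ C, ‖x + h • f x - z‖ ≤ ‖x + h • f x - y‖) ∧
      ∀ y ∈ C, ⟪x + h • f x - z, y - z⟫_ℝ ≤
        ‖x + h • f x - z‖ * (2 * r)⁻¹ * ‖y - z‖ ^ 2 := by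
  rcases eq_or_ne (f x) 0 with h0 | h0
  · exact ⟨x, hx, by simp [h0]⟩
  have hf : 0 < ‖f x‖ := norm_pos_iff.2 h0
  obtain ⟨z, hz, hg⟩ := hC x hx (h * ‖f x‖) (by positivity) hfr
  rw [mul_assoc, mul_inv_cancel₀ hf.ne', mul_one] at hz hg
  have hzp : z ∈ projSet C (x + h • f x) := hz ▸ mem_singleton z
  refine ⟨z, hzp.1, fun y hy => norm_sub_le_of_mem_projSet hzp hy, fun y hy => ?_⟩
  set d := x + h • f x - z
  rcases eq_or_ne d 0 with hd | hd
  · simp [hd]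
  have hd' : 0 < ‖d‖ := norm_pos_iff.2 hd
  have := inner_le_of_mem_gammaSet hr hg hy
  rw [real_inner_smul_left, inv_mul_le_iff₀ hd'] at this
  linarith

/-- A velocity of a curve in `C` is orthogonal to every proximal normal. -/
lemma inner_eq_zero_of_hasDerivAt {C : Set H} {c t : ℝ} {u : ℝ → H} {u' v : H}
    (hu : HasDerivAt u u' t) (huC : ∀ᶠ s in 𝓝 t, u s ∈ C)
    (hv : ∀ y ∈ C, ⟪v, y - u t⟫_ℝ ≤ c * ‖y - u t‖ ^ 2) : ⟪v, u'⟫_ℝ = 0 := by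
  have hs := hu.sub_const (u t)
  have h1 := (hs.norm_sq.const_mul c).sub ((hasDerivAt_const t v).inner ℝ hs)
  have hmin : IsLocalMin ((fun s => c * ‖u s - u t‖ ^ 2) - fun s => ⟪v, u s - u t⟫_ℝ) t := by
    filter_upwards [huC] with s hsC
    have := hv _ hsC
    simp only [Pi.sub_apply, sub_self, norm_zero, inner_zero_right]
    linarith
  have := hmin.hasDerivAt_eq_zero h1
  simpa using this

lemma norm_sub_le_of_inner_eq_zero {a b : H} (h : ⟪a - b, b⟫_ℝ = 0) : ‖a - b‖ ≤ ‖a‖ := by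
  refine le_of_sq_le_sq ?_ (norm_nonneg _)
  have := norm_add_sq_real (a - b) b
  rw [sub_add_cancel, h] at this
  nlinarith [sq_nonneg ‖b‖]

/-- Along a curve in the `(r,f)`-prox-regular set `C` whose velocity satisfies the sweeping
inclusion at time `t`, the active normal is a good direction at scale `r`. -/
lemma DirProxRegular.inner_le_of_hasDerivAt {r : ℝ} (hr : 0 < r) {f : H → H} {C : Set H}
    (hC : DirProxRegular r f C) {t : ℝ} {u : ℝ → H} {u' : H}
    (hu : HasDerivAt u u' t) (huC : ∀ᶠ s in 𝓝 t, u s ∈ C)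
    (hv : f (u t) - u' ∈ proxNormalCone C (u t)) :
    ⟪f (u t) - u', u'⟫_ℝ = 0 ∧ ∀ y ∈ C, ⟪f (u t) - u', y - u t⟫_ℝ ≤
      ‖f (u t) - u'‖ * (2 * r)⁻¹ * ‖y - u t‖ ^ 2 := by
  obtain ⟨s, hs, hsv⟩ := hv
  have hx : u t ∈ C := hsv.1
  have hv : ∀ y ∈ C, ⟪f (u t) - u', y - u t⟫_ℝ ≤ (2 * s)⁻¹ * ‖y - u t‖ ^ 2 :=
    fun y hy => inner_le_of_mem_gammaSet hs hsv hy
  have horth := inner_eq_zero_of_hasDerivAt hu huC hv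
  refine ⟨horth, fun y hy => ?_⟩
  set x := u t
  set v := f x - u' with hvdef
  have hsmall : ∀ᶠ ε in 𝓝[>] (0 : ℝ), ε * ‖f x‖ < r := by
    have : Tendsto (fun ε : ℝ => ε * ‖f x‖) (𝓝[>] 0) (𝓝 (0 * ‖f x‖)) :=
      (tendsto_id.mul_const _).mono_left nhdsWithin_le_nhds
    exact this.eventually (gt_mem_nhds (by simpa using hr))
  have hstep : ∀ ε : ℝ, ∃ z, 0 < ε → ε * ‖f x‖ < r → z ∈ C ∧
      (∀ y ∈ C, ‖x + ε • f x - z‖ ≤ ‖x + ε • f x - y‖) ∧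
      ∀ y ∈ C, ⟪x + ε • f x - z, y - z⟫_ℝ ≤
        ‖x + ε • f x - z‖ * (2 * r)⁻¹ * ‖y - z‖ ^ 2 := by
    intro ε
    by_cases h : 0 < ε ∧ ε * ‖f x‖ < r
    · obtain ⟨z, h1, h2⟩ := hC.exists_step hr hx h.1 h.2
      exact ⟨z, fun _ _ => ⟨h1, h2⟩⟩
    · exact ⟨0, fun h1 h2 => absurd ⟨h1, h2⟩ h⟩
  choose z hz using hstep
  have hslope : Tendsto (fun ε : ℝ => ε⁻¹ • (u (t + ε) - x)) (𝓝[>] 0) (𝓝 u') :=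
    (hasDerivAt_iff_tendsto_slope_zero.1 hu).mono_left
      (nhdsWithin_mono _ fun _ h => ne_of_gt h)
  have hutC : ∀ᶠ ε in 𝓝[>] (0 : ℝ), u (t + ε) ∈ C := by
    have : Tendsto (fun ε : ℝ => t + ε) (𝓝[>] 0) (𝓝 t) := by
      have : Tendsto (fun ε : ℝ => t + ε) (𝓝 0) (𝓝 (t + 0)) := tendsto_const_nhds.add tendsto_id
      rw [add_zero] at this
      exact this.mono_left nhdsWithin_le_nhds
    exact this.eventually huC
  have hpos : ∀ᶠ ε in 𝓝[>] (0 : ℝ), 0 < ε := self_mem_nhdsWithin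
  have hid : Tendsto (fun ε : ℝ => ε) (𝓝[>] 0) (𝓝 0) := nhdsWithin_le_nhds
  have hzx : ∀ᶠ ε in 𝓝[>] (0 : ℝ), ‖z ε - x‖ ≤ ε * (2 * ‖f x‖) := by
    filter_upwards [hsmall, hpos] with ε h1 h2
    have h3 := (hz ε h2 h1).2.1 x hx
    rw [add_sub_cancel_left, norm_smul, Real.norm_of_nonneg h2.le] at h3
    have e : z ε - x = ε • f x - (x + ε • f x - z ε) := by abel
    have h4 := norm_sub_le (ε • f x) (x + ε • f x - z ε)
    rw [← e, norm_smul, Real.norm_of_nonneg h2.le] at h4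
    linarith
  have hzlim : Tendsto z (𝓝[>] 0) (𝓝 x) := by
    rw [tendsto_iff_norm_sub_tendsto_zero]
    refine squeeze_zero' (Eventually.of_forall fun _ => norm_nonneg _) hzx ?_
    simpa using hid.mul_const (2 * ‖f x‖)
  have hdlim : Tendsto (fun ε => ε⁻¹ • (x + ε • f x - z ε)) (𝓝[>] 0) (𝓝 v) := by
    rw [tendsto_iff_norm_sub_tendsto_zero]
    have hsq : Tendsto (fun ε => ‖ε⁻¹ • (x + ε • f x - z ε) - v‖ ^ 2) (𝓝[>] 0) (𝓝 0) := by
      have hlim : Tendsto (fun ε : ℝ => ‖f x - ε⁻¹ • (u (t + ε) - x)‖ ^ 2 - ‖v‖ ^ 2 +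
          2 * ((2 * s)⁻¹ * (ε * (2 * ‖f x‖) ^ 2))) (𝓝[>] 0) (𝓝 0) := by
        have := (((hslope.const_sub (f x)).norm.pow 2).sub_const (‖v‖ ^ 2)).add
          (((hid.mul_const ((2 * ‖f x‖) ^ 2)).const_mul (2 * s)⁻¹).const_mul 2)
        simpa [hvdef] using this
      refine squeeze_zero' (Eventually.of_forall fun _ => by positivity) ?_ hlim
      filter_upwards [hsmall, hpos, hutC, hzx] with ε h1 h2 h3 h4
      obtain ⟨hzC, hmin, -⟩ := hz ε h2 h1
      set w := ε⁻¹ • (z ε - x) with hw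
      have hne := h2.ne'
      have e1 : ε⁻¹ • (x + ε • f x - z ε) = v + (u' - w) := by
        rw [hw, hvdef, smul_sub, smul_add, smul_smul, inv_mul_cancel₀ hne, smul_sub]
        module
      have e2 : ‖v + (u' - w)‖ ≤ ‖f x - ε⁻¹ • (u (t + ε) - x)‖ := by
        have h5 := mul_le_mul_of_nonneg_left (hmin _ h3) (inv_nonneg.2 h2.le)
        rw [← Real.norm_of_nonneg (inv_nonneg.2 h2.le), ← norm_smul, ← norm_smul, e1] at h5
        have e4 : f x - ε⁻¹ • (u (t + ε) - x) = ε⁻¹ • (x + ε • f x - u (t + ε)) := by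
          rw [smul_sub, smul_sub, smul_add, smul_smul, inv_mul_cancel₀ hne]
          module
        rwa [e4]
      have e3 : ⟪v, w⟫_ℝ ≤ (2 * s)⁻¹ * (ε * (2 * ‖f x‖) ^ 2) := by
        have h5 := hv _ hzC
        rw [hw, real_inner_smul_right, inv_mul_le_iff₀ h2]
        have h6 := pow_le_pow_left₀ (norm_nonneg _) h4 2
        have h7 := mul_le_mul_of_nonneg_left h6 (by positivity : 0 ≤ (2 * s)⁻¹)
        calc _ ≤ _ := h5
          _ ≤ _ := h7
          _ = _ := by ring
      rw [e1, add_sub_cancel_left]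
      have h8 := norm_add_sq_real v (u' - w)
      rw [inner_sub_right, horth] at h8
      have h9 := pow_le_pow_left₀ (norm_nonneg _) e2 2
      linarith
    have := hsq.sqrt
    simpa [Real.sqrt_sq] using this
  have hL := hdlim.inner (𝕜 := ℝ) (hzlim.const_sub y)
  have hR := (hdlim.norm.mul_const (2 * r)⁻¹).mul ((hzlim.const_sub y).norm.pow 2)
  refine le_of_tendsto_of_tendsto hL hR ?_
  filter_upwards [hsmall, hpos] with ε h1 h2
  have h3 := mul_le_mul_of_nonneg_left ((hz ε h2 h1).2.2 y hy) (inv_nonneg.2 h2.le)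
  rw [real_inner_smul_left, norm_smul, Real.norm_of_nonneg (inv_nonneg.2 h2.le)]
  calc _ ≤ _ := h3
    _ = _ := by ring

/-- A Lipschitz curve in a separable Hilbert space is the primitive of a bounded density. -/
lemma LipschitzWith.exists_integral_eq_sub [CompleteSpace H] [TopologicalSpace.SeparableSpace H]
    {L : NNReal} {u : ℝ → H} (hu : LipschitzWith L u) :
    ∃ g : ℝ → H, LocallyIntegrable g volume ∧ ∀ a b, ∫ s in a..b, g s = u b - u a := by
  obtain ⟨w, b, -⟩ := exists_hilbertBasis ℝ H
  have hw : Countable w := by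
    refine Pairwise.countable_of_isOpen_disjoint (s := fun i : w => Metric.ball (b i) (1 / 2))
      (fun i j hij => Metric.ball_disjoint_ball ?_) (fun _ => Metric.isOpen_ball)
      (fun i => ⟨b i, Metric.mem_ball_self (by norm_num)⟩)
    rw [dist_eq_norm]
    refine le_of_sq_le_sq ?_ (norm_nonneg _)
    rw [norm_sub_sq_real, b.orthonormal.1, b.orthonormal.1, b.orthonormal.2 hij]
    norm_num
  have hlip : ∀ i : w, LipschitzWith L fun t => ⟪b i, u t⟫_ℝ := fun i => by
    refine LipschitzWith.of_dist_le_mul fun s t => ?_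
    rw [Real.dist_eq, ← inner_sub_right]
    refine (abs_real_inner_le_norm _ _).trans ?_
    rw [b.orthonormal.1, one_mul, ← dist_eq_norm]
    exact hu.dist_le_mul s t
  have hdiff : ∀ᵐ t, ∀ i : w, DifferentiableAt ℝ (fun t => ⟪b i, u t⟫_ℝ) t :=
    ae_all_iff.2 fun i => (hlip i).ae_differentiableAt_real
  have hsq : ∀ᵐ t, ∀ F : Finset w, ∑ i ∈ F, (deriv (fun t => ⟪b i, u t⟫_ℝ) t) ^ 2 ≤ (L : ℝ) ^ 2 := by
    filter_upwards [hdiff] with t ht F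
    have hlim := tendsto_finsetSum F fun i _ =>
      (hasDerivAt_iff_tendsto_slope_zero.1 (ht i).hasDerivAt).pow 2
    refine le_of_tendsto hlim (eventually_mem_nhdsWithin.mono fun ε hε => ?_)
    have hB := b.orthonormal.sum_inner_products_le (ε⁻¹ • (u (t + ε) - u t)) (s := F)
    have hn : ‖ε⁻¹ • (u (t + ε) - u t)‖ ≤ L := by
      rw [norm_smul, norm_inv, inv_mul_le_iff₀ (norm_pos_iff.2 hε), mul_comm]
      have := hu.dist_le_mul (t + ε) t
      rwa [dist_eq_norm, dist_eq_norm, add_sub_cancel_left] at this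
    calc _ = ∑ i ∈ F, ‖⟪b i, ε⁻¹ • (u (t + ε) - u t)⟫_ℝ‖ ^ 2 := by
          refine Finset.sum_congr rfl fun i _ => ?_
          rw [real_inner_smul_right, inner_sub_right, Real.norm_eq_abs, sq_abs, smul_eq_mul]
      _ ≤ _ := hB
      _ ≤ _ := pow_le_pow_left₀ (norm_nonneg _) hn 2
  have hex : ∀ t, ∃ v : H, (∀ F : Finset w,
      ∑ i ∈ F, (deriv (fun t => ⟪b i, u t⟫_ℝ) t) ^ 2 ≤ (L : ℝ) ^ 2) →
      (HasSum (fun i => deriv (fun t => ⟪b i, u t⟫_ℝ) t • b i) v ∧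
        (∀ i, ⟪b i, v⟫_ℝ = deriv (fun t => ⟪b i, u t⟫_ℝ) t) ∧ ‖v‖ ≤ L) := by
    intro t
    by_cases h : ∀ F : Finset w, ∑ i ∈ F, (deriv (fun t => ⟪b i, u t⟫_ℝ) t) ^ 2 ≤ (L : ℝ) ^ 2
    swap
    · exact ⟨0, fun h' => absurd h' h⟩
    have hmem : Memℓp (fun i => deriv (fun t => ⟪b i, u t⟫_ℝ) t) 2 := by
      refine memℓp_gen' (C := (L : ℝ) ^ 2) fun F => ?_
      simpa using h F
    let φ : lp (fun _ : w => ℝ) 2 := ⟨_, hmem⟩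
    refine ⟨b.repr.symm φ, fun _ => ⟨b.hasSum_repr_symm φ, fun i => ?_, ?_⟩⟩
    · rw [← b.repr_apply_apply, LinearIsometryEquiv.apply_symm_apply]
    · rw [LinearIsometryEquiv.norm_map]
      refine lp.norm_le_of_forall_sum_le (by norm_num) L.2 fun F => ?_
      simpa using h F
  choose g hg using hex
  have hmeas : AEStronglyMeasurable g volume := by
    refine aestronglyMeasurable_of_tendsto_ae (u := (atTop : Filter (Finset w)))
      (f := fun F t => ∑ i ∈ F, deriv (fun t => ⟪b i, u t⟫_ℝ) t • b i) (fun F => ?_) ?_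
    · refine StronglyMeasurable.aestronglyMeasurable ?_
      refine Finset.stronglyMeasurable_fun_sum F fun i _ => ?_
      exact (stronglyMeasurable_deriv _).smul_const _
    · filter_upwards [hsq] with t ht
      exact (hg t ht).1
  have hint : LocallyIntegrable g volume := by
    have hc : LocallyIntegrable (fun _ : ℝ => (L : ℝ)) volume := locallyIntegrable_const _
    refine hc.mono hmeas ?_
    filter_upwards [hsq] with t ht
    simpa using (hg t ht).2.2
  refine ⟨g, hint, fun p q => ?_⟩
  refine b.repr.injective (lp.ext (funext fun i => ?_))
  rw [b.repr_apply_apply, b.repr_apply_apply, inner_sub_right]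
  have hI : IntervalIntegrable g volume p q :=
    (hint.integrableOn_isCompact isCompact_uIcc).mono_set uIoc_subset_uIcc
    |> intervalIntegrable_iff.mpr
  have h1 := (innerSL ℝ (b i)).intervalIntegral_comp_comm hI
  simp only [innerSL_apply_apply] at h1
  rw [← h1, ← ((hlip i).lipschitzOnWith).absolutelyContinuousOnInterval.integral_deriv_eq_sub]
  refine intervalIntegral.integral_congr_ae ?_
  filter_upwards [hsq] with t ht _
  exact (hg t ht).2.1 i

/-- Data of one step of the catching-up scheme: the projection step from `x` to `x'` with
time step `h`, whose scaled normal is bounded by `M` and hypomonotone with constant `c`. -/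
def IsCatchingStep (C : Set H) (f : H → H) (M c h : ℝ) (x x' : H) : Prop :=
  x' ∈ C ∧ ∃ v : H, ‖v‖ ≤ M ∧ x' = x + h • (f x - v) ∧
    ∀ y ∈ C, ⟪v, y - x'⟫_ℝ ≤ c * ‖y - x'‖ ^ 2

lemma DirProxRegular.exists_isCatchingStep {r M h : ℝ} (hr : 0 < r) {f : H → H} {C : Set H}
    (hC : DirProxRegular r f C) (hM : ∀ x, ‖f x‖ ≤ M) {x : H} (hx : x ∈ C)
    (hh : 0 < h) (hhM : h * M < r) :
    ∃ x', IsCatchingStep C f M (M * (2 * r)⁻¹) h x x' := by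
  obtain ⟨z, hz, hmin, hn⟩ := hC.exists_step hr hx hh
    ((mul_le_mul_of_nonneg_left (hM x) hh.le).trans_lt hhM)
  set d := x + h • f x - z with hd
  have hdn : ‖h⁻¹ • d‖ ≤ M := by
    have := hmin x hx
    rw [add_sub_cancel_left, norm_smul, Real.norm_of_nonneg hh.le] at this
    rw [norm_smul, norm_inv, Real.norm_of_nonneg hh.le, inv_mul_le_iff₀ hh]
    exact this.trans (mul_le_mul_of_nonneg_left (hM x) hh.le)
  refine ⟨z, hz, h⁻¹ • d, hdn, ?_, fun y hy => ?_⟩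
  · rw [smul_sub, smul_smul, mul_inv_cancel₀ hh.ne', hd]
    module
  · rw [norm_smul, norm_inv, Real.norm_of_nonneg hh.le] at hdn
    rw [real_inner_smul_left]
    calc h⁻¹ * ⟪d, y - z⟫_ℝ ≤ h⁻¹ * (‖d‖ * (2 * r)⁻¹ * ‖y - z‖ ^ 2) :=
          mul_le_mul_of_nonneg_left (hn y hy) (inv_nonneg.2 hh.le)
      _ = (h⁻¹ * ‖d‖) * ((2 * r)⁻¹ * ‖y - z‖ ^ 2) := by ring
      _ ≤ M * ((2 * r)⁻¹ * ‖y - z‖ ^ 2) := by gcongr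
      _ = _ := by ring

namespace IsCatchingStep

variable {C : Set H} {f : H → H} {M c h : ℝ} {x x' : H}

lemma norm_sub_le (hs : IsCatchingStep C f M c h x x') (hh : 0 ≤ h) (hM : ∀ x, ‖f x‖ ≤ M) :
    ‖x' - x‖ ≤ 2 * M * h := by
  obtain ⟨-, v, hv, rfl, -⟩ := hs
  rw [add_sub_cancel_left, norm_smul, Real.norm_of_nonneg hh]
  have := (_root_.norm_sub_le (f x) v).trans (add_le_add (hM x) hv)
  nlinarith

/-- Evolution variational inequality for one step. -/
lemma half_norm_sq_sub_le (hs : IsCatchingStep C f M c h x x') (hh : 0 ≤ h) {y : H} (hy : y ∈ C) :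
    ‖y - x'‖ ^ 2 / 2 - ‖y - x‖ ^ 2 / 2 ≤
      h * (c * ‖y - x'‖ ^ 2 - ⟪f x, y - x'⟫_ℝ) := by
  obtain ⟨-, v, -, hx', hn⟩ := hs
  have h1 := mul_le_mul_of_nonneg_left (hn y hy) hh
  have e : y - x = (y - x') + h • (f x - v) := by rw [hx']; abel
  have h2 := norm_add_sq_real (y - x') (h • (f x - v))
  rw [← e, real_inner_smul_right, inner_sub_right, real_inner_comm, real_inner_comm v] at h2
  nlinarith [sq_nonneg ‖h • (f x - v)‖]

/-- Comparison of one step of length `2 η` with two steps of length `η`. -/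
lemma norm_sq_sub_le {K : NNReal} (hf : LipschitzWith K f) (hM : ∀ x, ‖f x‖ ≤ M) (hc : 0 ≤ c)
    {η : ℝ} (hη : 0 < η) (hη1 : η ≤ 1) {y y₁ y₂ : H}
    (hx : IsCatchingStep C f M c (2 * η) x x') (hy₁ : IsCatchingStep C f M c η y y₁)
    (hy₂ : IsCatchingStep C f M c η y₁ y₂) :
    ‖x' - y₂‖ ^ 2 ≤ ‖x - y‖ ^ 2 + η * (4 * K + 18 * K * M + 10 * c) * ‖x' - y₂‖ ^ 2
      + η ^ 2 * (4 * M ^ 2 + 18 * K * M + 16 * c * M ^ 2) := by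
  have hx'x := hx.norm_sub_le (by positivity) hM
  have hy1y := hy₁.norm_sub_le hη.le hM
  have hy2y1 := hy₂.norm_sub_le hη.le hM
  obtain ⟨hx'C, v, hv, ex, hvn⟩ := hx
  obtain ⟨hy1C, w₁, hw₁, ey1, hwn₁⟩ := hy₁
  obtain ⟨hy2C, w₂, hw₂, ey2, hwn₂⟩ := hy₂
  have hM0 : 0 ≤ M := (norm_nonneg _).trans hv
  have hK : 0 ≤ (K : ℝ) := K.2
  obtain ⟨e, he⟩ : ∃ e, e = x' - y₂ := ⟨_, rfl⟩
  obtain ⟨D, hD⟩ : ∃ D, D = ‖e‖ := ⟨_, rfl⟩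
  rw [← he, ← hD]
  have hD0 : 0 ≤ D := hD ▸ norm_nonneg _
  have iv : -⟪v, e⟫_ℝ ≤ c * D ^ 2 := by
    have := hvn y₂ hy2C
    rwa [← neg_sub x' y₂, inner_neg_right, norm_neg, ← he, ← hD] at this
  have iw2 : ⟪w₂, e⟫_ℝ ≤ c * D ^ 2 := by
    rw [hD, he]
    exact hwn₂ x' hx'C
  have iw1 : ⟪w₁, e⟫_ℝ ≤ c * (2 * D ^ 2 + 8 * M ^ 2 * η ^ 2) + 2 * M ^ 2 * η := by
    have e1 : e = (x' - y₁) + (y₁ - y₂) := by rw [he]; abel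
    have h1 := hwn₁ x' hx'C
    have h2 : ⟪w₁, y₁ - y₂⟫_ℝ ≤ M * (2 * M * η) :=
      (real_inner_le_norm _ _).trans (mul_le_mul hw₁ (by rwa [norm_sub_rev]) (norm_nonneg _) hM0)
    have h3 : ‖x' - y₁‖ ≤ D + 2 * M * η := by
      have : x' - y₁ = e + (y₂ - y₁) := by rw [he]; abel
      rw [this, hD]
      exact (norm_add_le _ _).trans (by gcongr)
    have h4 : ‖x' - y₁‖ ^ 2 ≤ 2 * D ^ 2 + 8 * M ^ 2 * η ^ 2 := by
      have := pow_le_pow_left₀ (norm_nonneg _) h3 2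
      nlinarith [sq_nonneg (D - 2 * M * η)]
    have h5 := mul_le_mul_of_nonneg_left h4 hc
    rw [e1, inner_add_right]
    linarith
  have hd : ‖x - y‖ ≤ D + 8 * M * η := by
    have : x - y = -(x' - x) + e + ((y₂ - y₁) + (y₁ - y)) := by rw [he]; abel
    rw [this]
    refine (norm_add₃_le).trans ?_
    rw [norm_neg, ← hD]
    have := norm_add_le (y₂ - y₁) (y₁ - y)
    linarith
  have hd1 : ‖x - y₁‖ ≤ D + 10 * M * η := by
    have : x - y₁ = (x - y) - (y₁ - y) := by abel
    rw [this]
    have := _root_.norm_sub_le (x - y) (y₁ - y)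
    linarith
  have hff : ∀ a b : H, ∀ R, ‖a - b‖ ≤ R → ⟪f a - f b, e⟫_ℝ ≤ K * R * D := by
    intro a b R hR
    refine (real_inner_le_norm _ _).trans (hD ▸ mul_le_mul_of_nonneg_right ?_ hD0)
    have := hf.dist_le_mul a b
    rw [dist_eq_norm, dist_eq_norm] at this
    exact this.trans (mul_le_mul_of_nonneg_left hR hK)
  have if1 := hff x y _ hd
  have if2 := hff x y₁ _ hd1
  have hexp : D ^ 2 ≤ ‖x - y‖ ^ 2 + 2 * (η * (⟪f x - f y, e⟫_ℝ + ⟪f x - f y₁, e⟫_ℝ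
      - 2 * ⟪v, e⟫_ℝ + ⟪w₁, e⟫_ℝ + ⟪w₂, e⟫_ℝ)) := by
    have e1 : x - y = e - η • ((f x - f y) + (f x - f y₁) - (2 : ℝ) • v + w₁ + w₂) := by
      linear_combination (norm := module)
        (-1 : ℝ) • ex + ey2 + ey1 + (-1 : ℝ) • he
    rw [hD, e1, norm_sub_sq_real, real_inner_smul_right, real_inner_comm]
    simp only [inner_add_left, inner_sub_left _ ((2 : ℝ) • v), real_inner_smul_left]
    nlinarith [sq_nonneg ‖η • ((f x - f y) + (f x - f y₁) - (2 : ℝ) • v + w₁ + w₂)‖]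
  have hsum : ⟪f x - f y, e⟫_ℝ + ⟪f x - f y₁, e⟫_ℝ - 2 * ⟪v, e⟫_ℝ + ⟪w₁, e⟫_ℝ + ⟪w₂, e⟫_ℝ ≤
      (2 * K + 9 * K * M + 5 * c) * D ^ 2
        + η * (2 * M ^ 2 + 9 * K * M + 8 * c * M ^ 2) := by
    have a1 : 2 * (η * D) ≤ D ^ 2 + η := by nlinarith [sq_nonneg (D - η)]
    have a2 := mul_le_mul_of_nonneg_left a1 (by positivity : 0 ≤ 9 * (K * M : ℝ))
    have a3 : c * (8 * M ^ 2 * η ^ 2) ≤ c * (8 * M ^ 2 * η) := by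
      gcongr
      nlinarith
    nlinarith
  have := mul_le_mul_of_nonneg_left hsum hη.le
  nlinarith

end IsCatchingStep

section CatchingUp

variable {C : Set H} {f : H → H} {K : NNReal} {M c : ℝ}

lemma norm_sub_le_of_isCatchingStep {h : ℝ} (hh : 0 ≤ h) (hM : ∀ x, ‖f x‖ ≤ M) {X : ℕ → H}
    (hX : ∀ k, IsCatchingStep C f M c h (X k) (X (k + 1))) {k l : ℕ} (hkl : k ≤ l) :
    ‖X l - X k‖ ≤ 2 * M * (h * ((l : ℝ) - k)) := by
  induction l, hkl using Nat.le_induction with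
  | base => simp
  | succ l _ ih =>
    have h1 := (hX l).norm_sub_le hh hM
    have h2 := norm_sub_le_norm_sub_add_norm_sub (X (l + 1)) (X l) (X k)
    push_cast
    linarith

lemma norm_sq_sub_le_of_isCatchingStep (hf : LipschitzWith K f) (hM : ∀ x, ‖f x‖ ≤ M)
    (hc : 0 ≤ c) {η : ℝ} (hη : 0 < η) (hη1 : η ≤ 1)
    (hηA : η * (4 * K + 18 * K * M + 10 * c) ≤ 1 / 2) {X Y : ℕ → H}
    (hX : ∀ k, IsCatchingStep C f M c (2 * η) (X k) (X (k + 1)))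
    (hY : ∀ k, IsCatchingStep C f M c η (Y k) (Y (k + 1))) (h0 : X 0 = Y 0) (k : ℕ) :
    ‖X k - Y (2 * k)‖ ^ 2 ≤ Real.exp (2 * (4 * K + 18 * K * M + 10 * c) * (η * k)) *
      (k * (η ^ 2 * (4 * M ^ 2 + 18 * K * M + 16 * c * M ^ 2))) := by
  have hM0 : 0 ≤ M := (norm_nonneg _).trans (hM 0)
  set A : ℝ := 4 * K + 18 * K * M + 10 * c with hA
  have hA0 : 0 ≤ A := by positivity
  set b : ℝ := η ^ 2 * (4 * M ^ 2 + 18 * K * M + 16 * c * M ^ 2) with hb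
  have hb0 : 0 ≤ b := by positivity
  induction k with
  | zero => simp [h0]
  | succ k ih =>
    have h1 := IsCatchingStep.norm_sq_sub_le hf hM hc hη hη1 (hX k) (hY (2 * k)) (hY (2 * k + 1))
    rw [← hA, ← hb] at h1
    have e : 2 * (k + 1) = 2 * k + 1 + 1 := by ring
    rw [e]
    set D := ‖X (k + 1) - Y (2 * k + 1 + 1)‖ ^ 2
    have hD : D ≤ (1 + 2 * (η * A)) * (‖X k - Y (2 * k)‖ ^ 2 + b) := by
      have h2 : D * (1 - η * A) ≤ ‖X k - Y (2 * k)‖ ^ 2 + b := by linarith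
      have h3 : 0 ≤ η * A := by positivity
      have h4 := mul_le_mul_of_nonneg_left h2 (by positivity : 0 ≤ 1 + 2 * (η * A))
      have h5 : 0 ≤ D * (η * A * (1 - 2 * (η * A))) :=
        mul_nonneg (sq_nonneg _) (mul_nonneg h3 (by linarith))
      nlinarith
    have hexp : 1 + 2 * (η * A) ≤ Real.exp (2 * (η * A)) := by
      linarith [Real.add_one_le_exp (2 * (η * A))]
    have hE : 1 ≤ Real.exp (2 * A * (η * k)) := Real.one_le_exp (by positivity)
    calc D ≤ (1 + 2 * (η * A)) * (‖X k - Y (2 * k)‖ ^ 2 + b) := hD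
      _ ≤ Real.exp (2 * (η * A)) * (Real.exp (2 * A * (η * k)) * (k * b)
          + Real.exp (2 * A * (η * k)) * b) := by
        gcongr
        nlinarith
      _ = Real.exp (2 * (η * A)) * Real.exp (2 * A * (η * k)) * ((k + 1) * b) := by ring
      _ = _ := by
        rw [← Real.exp_add]
        push_cast
        ring_nf

lemma Nat.floor_two_mul_eq_or (a : ℝ) :
    ⌊2 * a⌋₊ = 2 * ⌊a⌋₊ ∨ ⌊2 * a⌋₊ = 2 * ⌊a⌋₊ + 1 := by
  rcases lt_or_ge a 0 with ha | ha
  · simp [Nat.floor_of_nonpos ha.le, Nat.floor_of_nonpos (by linarith : 2 * a ≤ 0)]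
  have h1 : 2 * ⌊a⌋₊ ≤ ⌊2 * a⌋₊ := by
    refine Nat.le_floor ?_
    push_cast
    linarith [Nat.floor_le ha]
  have h2 : ⌊2 * a⌋₊ < 2 * ⌊a⌋₊ + 2 := by
    refine (Nat.floor_lt (by positivity)).2 ?_
    push_cast
    linarith [Nat.lt_floor_add_one a]
  omega

/-- The dyadic catching-up approximations converge pointwise. -/
lemma exists_tendsto_catchingUp [CompleteSpace H] (hf : LipschitzWith K f) (hM : ∀ x, ‖f x‖ ≤ M)
    (hc : 0 ≤ c) {τ : ℝ} (hτ : 0 < τ) (hτ1 : τ ≤ 1)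
    (hτA : τ * (4 * K + 18 * K * M + 10 * c) ≤ 1 / 2) {X : ℕ → ℕ → H} {u₀ : H}
    (h0 : ∀ n, X n 0 = u₀)
    (hX : ∀ n k, IsCatchingStep C f M c (τ * (1 / 2) ^ n) (X n k) (X n (k + 1))) (t : ℝ) :
    ∃ x, Tendsto (fun n => X n ⌊t / (τ * (1 / 2) ^ n)⌋₊) atTop (𝓝 x) := by
  have hM0 : 0 ≤ M := (norm_nonneg _).trans (hM 0)
  set A : ℝ := 4 * K + 18 * K * M + 10 * c with hA
  have hA0 : 0 ≤ A := by positivity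
  set B : ℝ := 4 * M ^ 2 + 18 * K * M + 16 * c * M ^ 2 with hB
  have hB0 : 0 ≤ B := by positivity
  set Q : ℝ := Real.exp (A * |t|) * (|t| * (τ * B)) with hQ
  have hQ0 : 0 ≤ Q := by positivity
  set ρ : ℝ := √(1 / 2) with hρ
  have hρ0 : 0 ≤ ρ := Real.sqrt_nonneg _
  have hρsq : ρ ^ 2 = 1 / 2 := Real.sq_sqrt (by norm_num)
  have hρ1 : ρ < 1 := by nlinarith
  have hρ2 : 1 / 2 ≤ ρ := by nlinarith
  refine cauchySeq_tendsto_of_complete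
    (cauchySeq_of_le_geometric ρ (√Q + 2 * M * τ) hρ1 fun n => ?_)
  set η : ℝ := τ * (1 / 2) ^ (n + 1) with hη
  have hη0 : 0 < η := by positivity
  have hηn : τ * (1 / 2) ^ n = 2 * η := by rw [hη, pow_succ]; ring
  have hητ : η ≤ τ := mul_le_of_le_one_right hτ.le (pow_le_one₀ (by norm_num) (by norm_num))
  have hηρ : η ≤ τ * ρ ^ n := by
    refine mul_le_mul_of_nonneg_left ?_ hτ.le
    rw [pow_succ]
    have := pow_le_pow_left₀ (by norm_num) hρ2 n
    have h2 : (0 : ℝ) ≤ (1 / 2) ^ n := by positivity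
    linarith
  rw [hηn]
  set k := ⌊t / (2 * η)⌋₊ with hk
  have hkt : 2 * (η * k) ≤ |t| := by
    have h1 : (k : ℝ) ≤ |t| / (2 * η) :=
      (Nat.cast_le.2 (Nat.floor_le_floor (by gcongr; exact le_abs_self t))).trans
        (Nat.floor_le (by positivity))
    rw [le_div_iff₀ (by positivity)] at h1
    linarith
  have hXn : ∀ k, IsCatchingStep C f M c (2 * η) (X n k) (X n (k + 1)) := fun k => hηn ▸ hX n k
  have hmain : ‖X n k - X (n + 1) (2 * k)‖ ≤ √Q * ρ ^ n := by
    refine le_of_sq_le_sq ?_ (by positivity)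
    have h1 := norm_sq_sub_le_of_isCatchingStep hf hM hc hη0 (hητ.trans hτ1)
      ((mul_le_mul_of_nonneg_right hητ hA0).trans hτA) hXn (hX (n + 1))
      ((h0 n).trans (h0 (n + 1)).symm) k
    rw [← hA, ← hB] at h1
    rw [mul_pow, Real.sq_sqrt hQ0, ← pow_mul, mul_comm n 2, pow_mul, hρsq]
    refine h1.trans ?_
    have h2 : 2 * A * (η * k) ≤ A * |t| := by nlinarith
    have h3 : k * (η ^ 2 * B) ≤ |t| * (τ * B) * (1 / 2) ^ n := by
      have h4 : η ≤ τ * (1 / 2) ^ n := by linarith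
      have h5 : η * k ≤ |t| := by linarith [mul_nonneg hη0.le k.cast_nonneg]
      calc k * (η ^ 2 * B) = (η * k) * (η * B) := by ring
        _ ≤ |t| * (τ * (1 / 2) ^ n * B) := by gcongr
        _ = _ := by ring
    calc _ ≤ Real.exp (A * |t|) * (|t| * (τ * B) * (1 / 2) ^ n) := by gcongr
      _ = _ := by rw [hQ]; ring
  have hk' : ‖X (n + 1) (2 * k) - X (n + 1) ⌊t / η⌋₊‖ ≤ 2 * M * η := by
    have e : t / η = 2 * (t / (2 * η)) := by field_simp
    rw [e]
    rcases Nat.floor_two_mul_eq_or (t / (2 * η)) with h | h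
    · rw [h, ← hk, sub_self, norm_zero]
      positivity
    · rw [h, ← hk, norm_sub_rev]
      exact (hX (n + 1) (2 * k)).norm_sub_le hη0.le hM
  rw [dist_eq_norm]
  calc _ ≤ √Q * ρ ^ n + 2 * M * η :=
        (norm_sub_le_norm_sub_add_norm_sub _ _ _).trans (add_le_add hmain hk')
    _ ≤ √Q * ρ ^ n + 2 * M * (τ * ρ ^ n) := by gcongr
    _ = _ := by ring

lemma mul_natFloor_sub_le {h s t : ℝ} (hh : 0 < h) (hst : s ≤ t) :
    h * ((⌊t / h⌋₊ : ℝ) - ⌊s / h⌋₊) ≤ (t - s) + h := by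
  have h1 : s / h < ⌊s / h⌋₊ + 1 := Nat.lt_floor_add_one _
  rw [div_lt_iff₀ hh] at h1
  rcases lt_or_ge t 0 with ht | ht
  · rw [Nat.floor_of_nonpos (div_nonpos_of_nonpos_of_nonneg ht.le hh.le)]
    have : 0 ≤ h * (⌊s / h⌋₊ : ℝ) := by positivity
    push_cast
    linarith
  · have h2 : (⌊t / h⌋₊ : ℝ) ≤ t / h := Nat.floor_le (by positivity)
    rw [le_div_iff₀ hh] at h2
    linarith

lemma tendsto_mul_natFloor_div {h : ℕ → ℝ} (hh : ∀ n, 0 < h n) (hlim : Tendsto h atTop (𝓝 0))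
    {t : ℝ} (ht : 0 ≤ t) : Tendsto (fun n => h n * (⌊t / h n⌋₊ : ℝ)) atTop (𝓝 t) := by
  refine tendsto_of_tendsto_of_tendsto_of_le_of_le (g := fun n => t - h n)
    (by simpa using hlim.const_sub t) (tendsto_const_nhds (x := t)) (fun n => ?_) fun n => ?_
  · have h1 : t / h n < ⌊t / h n⌋₊ + 1 := Nat.lt_floor_add_one _
    rw [div_lt_iff₀ (hh n)] at h1
    dsimp only
    linarith
  · have h2 : (⌊t / h n⌋₊ : ℝ) ≤ t / h n := Nat.floor_le (div_nonneg ht (hh n).le)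
    rw [le_div_iff₀ (hh n)] at h2
    dsimp only
    linarith

variable {h : ℕ → ℝ} {X : ℕ → ℕ → H} {u : ℝ → H}

lemma lipschitzWith_of_tendsto_catchingUp (hM : ∀ x, ‖f x‖ ≤ M) (hh : ∀ n, 0 < h n)
    (hlim : Tendsto h atTop (𝓝 0))
    (hX : ∀ n k, IsCatchingStep C f M c (h n) (X n k) (X n (k + 1)))
    (hu : ∀ t, Tendsto (fun n => X n ⌊t / h n⌋₊) atTop (𝓝 (u t))) :
    LipschitzWith (2 * M).toNNReal u := by
  have hM0 : 0 ≤ M := (norm_nonneg _).trans (hM 0)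
  have key : ∀ s t, s ≤ t → dist (u t) (u s) ≤ 2 * M * (t - s) := by
    intro s t hst
    rw [dist_eq_norm]
    have hR : Tendsto (fun n => 2 * M * ((t - s) + h n)) atTop (𝓝 (2 * M * (t - s))) := by
      simpa using (hlim.const_add (t - s)).const_mul (2 * M)
    refine le_of_tendsto_of_tendsto' ((hu t).sub (hu s)).norm hR fun n => ?_
    have hfl : ⌊s / h n⌋₊ ≤ ⌊t / h n⌋₊ :=
      Nat.floor_le_floor (div_le_div_of_nonneg_right hst (hh n).le)
    refine (norm_sub_le_of_isCatchingStep (hh n).le hM (hX n) hfl).trans ?_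
    exact mul_le_mul_of_nonneg_left (mul_natFloor_sub_le (hh n) hst) (by positivity)
  refine LipschitzWith.of_dist_le_mul fun s t => ?_
  rw [Real.coe_toNNReal _ (by positivity)]
  rcases le_total s t with hst | hst
  · rw [dist_comm, Real.dist_eq, abs_sub_comm, abs_of_nonneg (sub_nonneg.2 hst)]
    exact key s t hst
  · rw [Real.dist_eq, abs_of_nonneg (sub_nonneg.2 hst)]
    exact key t s hst

lemma exists_half_norm_sq_sub_le_of_tendsto_catchingUp (hf : LipschitzWith K f)
    (hM : ∀ x, ‖f x‖ ≤ M) (hh : ∀ n, 0 < h n) (hlim : Tendsto h atTop (𝓝 0))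
    (hX : ∀ n k, IsCatchingStep C f M c (h n) (X n k) (X n (k + 1)))
    (hu : ∀ t, Tendsto (fun n => X n ⌊t / h n⌋₊) atTop (𝓝 (u t)))
    {t : ℝ} (ht : 0 ≤ t) {y : H} (hy : y ∈ C) {m : ℝ}
    (hm : c * ‖y - u t‖ ^ 2 - ⟪f (u t), y - u t⟫_ℝ < m) :
    ∃ δ > 0, ∀ t' ∈ Ioo t (t + δ),
      ‖y - u t'‖ ^ 2 / 2 - ‖y - u t‖ ^ 2 / 2 ≤ (t' - t) * m := by
  have hM0 : 0 ≤ M := (norm_nonneg _).trans (hM 0)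
  obtain ⟨δ, hδ, hδm⟩ : ∃ δ > 0, ∀ a b, ‖a - u t‖ < δ → ‖b - u t‖ < δ →
      c * ‖y - b‖ ^ 2 - ⟪f a, y - b⟫_ℝ < m := by
    have hcont : Continuous fun p : H × H => c * ‖y - p.2‖ ^ 2 - ⟪f p.1, y - p.2⟫_ℝ := by
      have := hf.continuous
      fun_prop
    obtain ⟨δ, hδ, h1⟩ := Metric.eventually_nhds_iff.1
      (hcont.continuousAt (x := (u t, u t)) |>.eventually (gt_mem_nhds hm))
    refine ⟨δ, hδ, fun a b ha hb => h1 (y := (a, b)) ?_⟩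
    rw [Prod.dist_eq, dist_eq_norm, dist_eq_norm]
    exact max_lt ha hb
  refine ⟨δ / (2 * M + 1), by positivity, fun t' ht' => ?_⟩
  have htt' : 2 * M * (t' - t) < δ := by
    have h1 : t' - t < δ / (2 * M + 1) := by linarith [ht'.2]
    rw [lt_div_iff₀ (by positivity)] at h1
    nlinarith [ht'.1]
  have hev : ∀ᶠ n in atTop,
      2 * M * ((t' - t) + h n) + ‖X n ⌊t / h n⌋₊ - u t‖ < δ := by
    have h1 := ((hlim.const_add (t' - t)).const_mul (2 * M)).add
      (tendsto_iff_norm_sub_tendsto_zero.1 (hu t))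
    rw [add_zero, add_zero] at h1
    exact h1.eventually (gt_mem_nhds htt')
  have hL := (((hu t').const_sub y).norm.pow 2 |>.div_const 2).sub
    (((hu t).const_sub y).norm.pow 2 |>.div_const 2)
  have hR := ((tendsto_mul_natFloor_div hh hlim (ht.trans ht'.1.le)).sub
    (tendsto_mul_natFloor_div hh hlim ht)).mul_const m
  refine le_of_tendsto_of_tendsto hL hR ?_
  filter_upwards [hev] with n hn
  set k := ⌊t / h n⌋₊ with hk
  have hnear : ∀ i, k ≤ i → i ≤ ⌊t' / h n⌋₊ → ‖X n i - u t‖ < δ := by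
    intro i hki hil
    have h1 := norm_sub_le_of_isCatchingStep (hh n).le hM (hX n) hki
    have h2 := norm_sub_le_norm_sub_add_norm_sub (X n i) (X n k) (u t)
    have h3 : h n * ((i : ℝ) - k) ≤ (t' - t) + h n := by
      refine le_trans ?_ (mul_natFloor_sub_le (hh n) ht'.1.le)
      rw [← hk]
      have : (i : ℝ) ≤ ⌊t' / h n⌋₊ := Nat.cast_le.2 hil
      exact mul_le_mul_of_nonneg_left (by linarith) (hh n).le
    have h4 := mul_le_mul_of_nonneg_left h3 (by positivity : 0 ≤ 2 * M)
    linarith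
  have hsum : ∀ l, k ≤ l → l ≤ ⌊t' / h n⌋₊ →
      ‖y - X n l‖ ^ 2 / 2 - ‖y - X n k‖ ^ 2 / 2 ≤ h n * ((l : ℝ) - k) * m := by
    intro l hkl
    induction l, hkl using Nat.le_induction with
    | base => simp
    | succ l hkl ih =>
      intro hl
      have h1 := ih (by omega)
      have h2 := (hX n l).half_norm_sq_sub_le (hh n).le hy
      have h3 := hδm _ _ (hnear l hkl (by omega)) (hnear (l + 1) (by omega) hl)
      have h4 := mul_le_mul_of_nonneg_left h3.le (hh n).le
      push_cast
      linarith
  have := hsum _ (Nat.floor_le_floor (div_le_div_of_nonneg_right ht'.1.le (hh n).le)) le_rfl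
  rwa [mul_sub] at this

lemma inner_le_of_tendsto_catchingUp (hf : LipschitzWith K f)
    (hM : ∀ x, ‖f x‖ ≤ M) (hh : ∀ n, 0 < h n) (hlim : Tendsto h atTop (𝓝 0))
    (hX : ∀ n k, IsCatchingStep C f M c (h n) (X n k) (X n (k + 1)))
    (hu : ∀ t, Tendsto (fun n => X n ⌊t / h n⌋₊) atTop (𝓝 (u t)))
    {t : ℝ} (ht : 0 ≤ t) {u' : H} (hu' : HasDerivAt u u' t) {y : H} (hy : y ∈ C) :
    ⟪f (u t) - u', y - u t⟫_ℝ ≤ c * ‖y - u t‖ ^ 2 := by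
  have hder : HasDerivAt (fun s => ‖y - u s‖ ^ 2 / 2) (-⟪u', y - u t⟫_ℝ) t := by
    refine ((hu'.const_sub y).norm_sq.div_const 2).congr_deriv ?_
    rw [inner_neg_right, real_inner_comm]
    ring
  have key : -⟪u', y - u t⟫_ℝ ≤ c * ‖y - u t‖ ^ 2 - ⟪f (u t), y - u t⟫_ℝ := by
    refine le_of_forall_gt_imp_ge_of_dense fun m hm => ?_
    obtain ⟨δ, hδ, h1⟩ :=
      exists_half_norm_sq_sub_le_of_tendsto_catchingUp hf hM hh hlim hX hu ht hy hm
    have hs := (hasDerivAt_iff_tendsto_slope.1 hder).mono_left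
      (nhdsWithin_mono t fun s (hs : s ∈ Ioi t) => ne_of_gt hs)
    refine le_of_tendsto hs ?_
    filter_upwards [Ioo_mem_nhdsGT (by linarith : t < t + δ)] with s hs
    rw [slope_def_field, div_le_iff₀ (sub_pos.2 hs.1), mul_comm]
    exact h1 s hs
  rw [inner_sub_left]
  linarith

end CatchingUp

/-- Existence for the sweeping process, with a globally Lipschitz trajectory which satisfies the
hypomonotone inclusion at each positive time where it is differentiable. -/
lemma DirProxRegular.exists_lipschitzWith_sol [CompleteSpace H] {r M : ℝ} (hr : 0 < r)
    {f : H → H} {C : Set H} (hCcl : IsClosed C) (hC : DirProxRegular r f C) {K : NNReal}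
    (hf : LipschitzWith K f) (hM : ∀ x, ‖f x‖ ≤ M) {u₀ : H} (hu₀ : u₀ ∈ C) :
    ∃ u : ℝ → H, LipschitzWith (2 * M).toNNReal u ∧ u 0 = u₀ ∧ (∀ t, u t ∈ C) ∧
      ∀ t, 0 ≤ t → ∀ u', HasDerivAt u u' t → ∀ y ∈ C,
        ⟪f (u t) - u', y - u t⟫_ℝ ≤ M * (2 * r)⁻¹ * ‖y - u t‖ ^ 2 := by
  have hM0 : 0 ≤ M := (norm_nonneg _).trans (hM 0)
  set c : ℝ := M * (2 * r)⁻¹ with hcdef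
  have hc : 0 ≤ c := by positivity
  have hA : 0 ≤ 4 * K + 18 * K * M + 10 * c := by positivity
  obtain ⟨τ, hτ, hτ1, hτA, hτM⟩ : ∃ τ : ℝ, 0 < τ ∧ τ ≤ 1 ∧
      τ * (4 * K + 18 * K * M + 10 * c) ≤ 1 / 2 ∧ τ * M < r := by
    have h1 : Tendsto (fun τ : ℝ => τ * (4 * K + 18 * K * M + 10 * c)) (𝓝[>] 0) (𝓝 0) := by
      simpa using (tendsto_id.mul_const (4 * K + 18 * K * M + 10 * c)).mono_left
        (nhdsWithin_le_nhds (a := (0 : ℝ)) (s := Ioi 0))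
    have h2 : Tendsto (fun τ : ℝ => τ * M) (𝓝[>] 0) (𝓝 0) := by
      simpa using (tendsto_id.mul_const M).mono_left
        (nhdsWithin_le_nhds (a := (0 : ℝ)) (s := Ioi 0))
    have h3 : ∀ᶠ τ in 𝓝[>] (0 : ℝ), τ ∈ Ioo 0 1 := Ioo_mem_nhdsGT one_pos
    obtain ⟨τ, h4, h5, h6⟩ := (h3.and ((h1.eventually (gt_mem_nhds one_half_pos)).and
      (h2.eventually (gt_mem_nhds hr)))).exists
    exact ⟨τ, h4.1, h4.2.le, h5.le, h6⟩
  set h : ℕ → ℝ := fun n => τ * (1 / 2) ^ n with hh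
  have hpos : ∀ n, 0 < h n := fun n => by positivity
  have hle : ∀ n, h n ≤ τ := fun n =>
    mul_le_of_le_one_right hτ.le (pow_le_one₀ (by norm_num) (by norm_num))
  have hlim : Tendsto h atTop (𝓝 0) := by
    have := (tendsto_pow_atTop_nhds_zero_of_lt_one
      (by norm_num : (0 : ℝ) ≤ 1 / 2) (by norm_num)).const_mul τ
    rwa [mul_zero] at this
  have hstep : ∀ n (x : C), ∃ x' : C, IsCatchingStep C f M c (h n) x x' := fun n x => by
    obtain ⟨x', hx'⟩ := hC.exists_isCatchingStep hr hM x.2 (hpos n)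
      ((mul_le_mul_of_nonneg_right (hle n) hM0).trans_lt hτM)
    exact ⟨⟨x', hx'.1⟩, hx'⟩
  choose S hS using hstep
  have hX : ∀ n k, IsCatchingStep C f M c (h n) ((S n)^[k] ⟨u₀, hu₀⟩) ((S n)^[k + 1] ⟨u₀, hu₀⟩) :=
    fun n k => by
      rw [Function.iterate_succ_apply']
      exact hS n _
  choose u hu using exists_tendsto_catchingUp hf hM hc hτ hτ1 hτA
    (X := fun n k => ((S n)^[k] ⟨u₀, hu₀⟩ : H)) (u₀ := u₀) (fun n => rfl) hX
  refine ⟨u, lipschitzWith_of_tendsto_catchingUp hM hpos hlim hX hu, ?_, fun t => ?_,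
    fun t ht u' hu' y hy => inner_le_of_tendsto_catchingUp hf hM hpos hlim hX hu ht hu' hy⟩
  · refine tendsto_nhds_unique (hu 0) ?_
    simp
  · exact hCcl.mem_of_tendsto (hu t) (Eventually.of_forall fun n => Subtype.coe_prop _)

lemma ae_hasDerivAt_of_eq_add_integral [CompleteSpace H] {T : ℝ} (hT : 0 < T) {u g : ℝ → H}
    {u₀ : H} (hg : IntegrableOn g (Icc 0 T))
    (hu : ∀ t ∈ Icc (0 : ℝ) T, u t = u₀ + ∫ s in (0 : ℝ)..t, g s) :
    ∀ᵐ t, t ∈ Ioo 0 T → HasDerivAt u (g t) t := by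
  have hI : IntervalIntegrable g volume 0 T :=
    (intervalIntegrable_iff_integrableOn_Icc_of_le hT.le).2 hg
  filter_upwards [hI.ae_hasDerivAt_integral] with t ht hmem
  rw [uIcc_of_le hT.le] at ht
  have h1 := (ht (Ioo_subset_Icc_self hmem) 0 (left_mem_Icc.2 hT.le)).const_add u₀
  refine h1.congr_of_eventuallyEq ?_
  filter_upwards [Icc_mem_nhds hmem.1 hmem.2] with s hs using hu s hs

/-- Regularity of an arbitrary solution. -/
lemma DirProxRegular.ae_of_isSweepingSol [CompleteSpace H] {r M T : ℝ} (hr : 0 < r) (hT : 0 < T)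
    {f : H → H} {C : Set H} (hC : DirProxRegular r f C) (hM : ∀ x, ‖f x‖ ≤ M)
    {u₀ : H} {u : ℝ → H} (hu : IsSweepingSol (fun _ => C) f T u₀ u) :
    AbsolutelyContinuousOnInterval u 0 T ∧ ∀ᵐ t, t ∈ Ioo 0 T → ∃ u', HasDerivAt u u' t ∧
      ∀ y ∈ C, ⟪f (u t) - u', y - u t⟫_ℝ ≤ M * (2 * r)⁻¹ * ‖y - u t‖ ^ 2 := by
  have hM0 : 0 ≤ M := (norm_nonneg _).trans (hM 0)
  obtain ⟨g, hg, hug, huC, hN⟩ := hu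
  rw [ae_restrict_iff' measurableSet_Icc] at hN
  have hreg : ∀ᵐ t, t ∈ Ioo 0 T → HasDerivAt u (g t) t ∧ ‖f (u t) - g t‖ ≤ M ∧
      ∀ y ∈ C, ⟪f (u t) - g t, y - u t⟫_ℝ ≤ M * (2 * r)⁻¹ * ‖y - u t‖ ^ 2 := by
    filter_upwards [ae_hasDerivAt_of_eq_add_integral hT hg hug, hN] with t h1 h2 ht
    have huC' : ∀ᶠ s in 𝓝 t, u s ∈ C := by
      filter_upwards [Icc_mem_nhds ht.1 ht.2] with s hs using huC s hs
    obtain ⟨horth, hn⟩ := hC.inner_le_of_hasDerivAt hr (h1 ht) huC' (h2 (Ioo_subset_Icc_self ht))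
    have hb := (norm_sub_le_of_inner_eq_zero horth).trans (hM _)
    refine ⟨h1 ht, hb, fun y hy => (hn y hy).trans ?_⟩
    gcongr
  refine ⟨LipschitzOnWith.absolutelyContinuousOnInterval (K := (2 * M).toNNReal) ?_, ?_⟩
  · rw [uIcc_of_le hT.le]
    refine LipschitzOnWith.of_dist_le_mul fun s hs t ht => ?_
    rw [Real.coe_toNNReal _ (by positivity), dist_eq_norm, Real.dist_eq]
    have hI : ∀ a ∈ Icc (0 : ℝ) T, IntervalIntegrable g volume 0 a := fun a ha =>
      (intervalIntegrable_iff_integrableOn_Icc_of_le ha.1).2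
        (hg.mono_set (Icc_subset_Icc_right ha.2))
    rw [hug s hs, hug t ht, add_sub_add_left_eq_sub,
      intervalIntegral.integral_interval_sub_left (hI s hs) (hI t ht)]
    refine intervalIntegral.norm_integral_le_of_norm_le_const_ae ?_
    have hne : ∀ᵐ x : ℝ, x ≠ T := by simp [ae_iff]
    filter_upwards [hreg, hne] with x hx hxT hmem
    have hx0 : 0 < x := (le_min ht.1 hs.1).trans_lt hmem.1
    have hxT' : x < T := lt_of_le_of_ne (hmem.2.trans (max_le ht.2 hs.2)) hxT
    have h1 := (hx ⟨hx0, hxT'⟩).2.1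
    have h2 := norm_sub_le (f (u x)) (f (u x) - g x)
    rw [sub_sub_cancel] at h2
    linarith [hM (u x)]
  · filter_upwards [hreg] with t ht hmem
    exact ⟨g t, (ht hmem).1, (ht hmem).2.2⟩

lemma eqOn_of_hypomonotone {T c : ℝ} (hT : 0 < T) {f : H → H} {C : Set H} {K : NNReal}
    (hf : LipschitzWith K f) {u v : ℝ → H} (h0 : u 0 = v 0)
    (huC : ∀ t ∈ Icc 0 T, u t ∈ C) (hvC : ∀ t ∈ Icc 0 T, v t ∈ C)
    (hu : AbsolutelyContinuousOnInterval u 0 T) (hv : AbsolutelyContinuousOnInterval v 0 T)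
    (hu' : ∀ᵐ t, t ∈ Ioo 0 T → ∃ u', HasDerivAt u u' t ∧
      ∀ y ∈ C, ⟪f (u t) - u', y - u t⟫_ℝ ≤ c * ‖y - u t‖ ^ 2)
    (hv' : ∀ᵐ t, t ∈ Ioo 0 T → ∃ v', HasDerivAt v v' t ∧
      ∀ y ∈ C, ⟪f (v t) - v', y - v t⟫_ℝ ≤ c * ‖y - v t‖ ^ 2) :
    EqOn u v (Icc 0 T) := by
  set L : ℝ := 2 * K + 4 * c with hL
  set φ : ℝ → ℝ := fun t => ‖u t - v t‖ ^ 2 * Real.exp (-L * t) with hφ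
  have hn : AbsolutelyContinuousOnInterval (fun t => ‖u t - v t‖) 0 T := by
    have := hu.sub hv
    rw [absolutelyContinuousOnInterval_iff] at this ⊢
    intro ε hε
    obtain ⟨δ, hδ, h1⟩ := this ε hε
    refine ⟨δ, hδ, fun E hE hEδ => lt_of_le_of_lt (Finset.sum_le_sum fun i _ => ?_) (h1 E hE hEδ)⟩
    rw [Real.dist_eq, dist_eq_norm]
    exact abs_norm_sub_norm_le _ _
  have hφac : AbsolutelyContinuousOnInterval φ 0 T := by
    have hexp : AbsolutelyContinuousOnInterval (fun t => Real.exp (-L * t)) 0 T := by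
      refine ContDiffOn.absolutelyContinuousOnInterval (ContDiff.contDiffOn ?_)
      fun_prop
    convert (hn.mul hn).mul hexp using 1
    ext t
    simp [hφ, sq]
  have hφ' : ∀ᵐ t, t ∈ Ioo 0 T → deriv φ t ≤ 0 := by
    filter_upwards [hu', hv'] with t h1 h2 ht
    obtain ⟨a, ha, hat⟩ := h1 ht
    obtain ⟨b, hb, hbt⟩ := h2 ht
    have hexp : HasDerivAt (fun t => Real.exp (-L * t)) (Real.exp (-L * t) * (-L)) t := by
      simpa using ((hasDerivAt_id t).const_mul (-L)).exp
    have hd : HasDerivAt φ _ t := (ha.sub hb).norm_sq.mul hexp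
    rw [hd.deriv]
    have i1 := hat _ (hvC t (Ioo_subset_Icc_self ht))
    have i2 := hbt _ (huC t (Ioo_subset_Icc_self ht))
    set D := u t - v t
    rw [← neg_sub (u t), norm_neg, inner_neg_right, inner_sub_left] at i1
    rw [inner_sub_left] at i2
    have i3 : ⟪f (u t), D⟫_ℝ - ⟪f (v t), D⟫_ℝ ≤ K * ‖D‖ ^ 2 := by
      rw [← inner_sub_left]
      refine (real_inner_le_norm _ _).trans ?_
      have := hf.dist_le_mul (u t) (v t)
      rw [dist_eq_norm, dist_eq_norm] at this
      nlinarith [norm_nonneg D]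
    have i4 : 2 * ⟪D, a - b⟫_ℝ ≤ L * ‖D‖ ^ 2 := by
      rw [real_inner_comm, inner_sub_left]
      linarith
    have i5 := mul_le_mul_of_nonneg_right i4 (Real.exp_pos (-L * t)).le
    change 2 * ⟪D, a - b⟫_ℝ * Real.exp (-L * t) + ‖D‖ ^ 2 * (Real.exp (-L * t) * -L) ≤ 0
    linarith
  intro t ht
  have hsub : uIcc 0 t ⊆ uIcc 0 T := by
    rw [uIcc_of_le ht.1, uIcc_of_le hT.le]
    exact Icc_subset_Icc_right ht.2
  have hint := (hφac.mono hsub).integral_deriv_eq_sub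
  have hle : ∫ x in (0 : ℝ)..t, deriv φ x ≤ 0 := by
    rw [intervalIntegral.integral_of_le ht.1]
    refine setIntegral_nonpos_ae measurableSet_Ioc ?_
    have hne : ∀ᵐ x : ℝ, x ≠ T := by simp [ae_iff]
    filter_upwards [hφ', hne] with x hx hxT hmem
    exact hx ⟨hmem.1, lt_of_le_of_ne (hmem.2.trans ht.2) hxT⟩
  have hφ0 : φ 0 = 0 := by simp [hφ, h0]
  rw [hint, hφ0, sub_zero] at hle
  have h1 : ‖u t - v t‖ ^ 2 ≤ 0 := by
    by_contra h
    exact absurd hle (not_le.2 (mul_pos (not_le.1 h) (Real.exp_pos _)))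
  exact sub_eq_zero.1 (norm_eq_zero.1 (pow_eq_zero_iff two_ne_zero |>.1
    (le_antisymm h1 (sq_nonneg _))))

end SweepingProcess


/-- **Sweeping process in a Hilbert space, constant set, bounded Lipschitz
perturbation.** Let `H` be a separable Hilbert space, `f : H → H` bounded and Lipschitz,
`r > 0` and `C ⊂ H` a nonempty `(r,f)`-prox-regular set. Then for every `u₀ ∈ C` the
sweeping process `u̇(t) + N(C,u(t)) ∋ f(u(t))`, `u(0) = u₀`, has one and only one
absolutely continuous solution `u`; it lives in `C` and its velocity satisfies
`‖u̇(t) - f(u(t))‖ ≤ ‖f‖_∞` a.e. on `I`. -/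
theorem sweeping_process_hilbert_constant_bounded
    {H : Type*} [NormedAddCommGroup H] [InnerProductSpace ℝ H] [CompleteSpace H]
    [TopologicalSpace.SeparableSpace H]
    (T : ℝ) (hT : 0 < T)
    (f : H → H) (K : NNReal) (hflip : LipschitzWith K f)
    (hfbdd : ∃ M : ℝ, ∀ x, ‖f x‖ ≤ M)
    (r : ℝ) (hr : 0 < r)
    (C : Set H) (hCne : C.Nonempty) (hCclosed : IsClosed C)
    (hCprox : DirProxRegular r f C)
    (u₀ : H) (hu₀ : u₀ ∈ C) :
    (∃ u g : ℝ → H, IntegrableOn g (Set.Icc 0 T) ∧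
      (∀ t ∈ Set.Icc (0:ℝ) T, u t = u₀ + ∫ s in (0:ℝ)..t, g s) ∧
      (∀ t ∈ Set.Icc (0:ℝ) T, u t ∈ C) ∧
      (∀ᵐ t ∂volume.restrict (Set.Icc (0:ℝ) T),
        f (u t) - g t ∈ proxNormalCone C (u t)) ∧
      (∀ᵐ t ∂volume.restrict (Set.Icc (0:ℝ) T),
        ‖g t - f (u t)‖ ≤ ⨆ x : H, ‖f x‖)) ∧
    ∀ u v : ℝ → H, IsSweepingSol (fun _ => C) f T u₀ u →
      IsSweepingSol (fun _ => C) f T u₀ v → Set.EqOn u v (Set.Icc 0 T) := by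
  have hbdd : BddAbove (range fun x => ‖f x‖) := by
    obtain ⟨M, hM⟩ := hfbdd
    exact ⟨M, forall_mem_range.2 hM⟩
  obtain ⟨M, hM0, hM⟩ : ∃ M : ℝ, 0 < M ∧ ∀ x, ‖f x‖ ≤ M := by
    obtain ⟨M, hM⟩ := hfbdd
    exact ⟨max M 1, by positivity, fun x => (hM x).trans (le_max_left _ _)⟩
  refine ⟨?_, fun u v hu hv => ?_⟩
  · obtain ⟨u, hulip, hu0, huC, hn⟩ :=
      hCprox.exists_lipschitzWith_sol hr hCclosed hflip hM hu₀
    obtain ⟨g, hg, hug⟩ := hulip.exists_integral_eq_sub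
    have hgI : IntegrableOn g (Icc 0 T) := hg.integrableOn_isCompact isCompact_Icc
    have hint : ∀ t ∈ Icc (0 : ℝ) T, u t = u₀ + ∫ s in (0 : ℝ)..t, g s := fun t _ => by
      rw [hug, hu0, add_sub_cancel]
    have hreg : ∀ᵐ t ∂volume.restrict (Icc (0 : ℝ) T),
        f (u t) - g t ∈ proxNormalCone C (u t) ∧ ‖g t - f (u t)‖ ≤ ⨆ x : H, ‖f x‖ := by
      rw [← restrict_Ioo_eq_restrict_Icc, ae_restrict_iff' measurableSet_Ioo]
      filter_upwards [ae_hasDerivAt_of_eq_add_integral hT hgI hint] with t ht hmem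
      have hy := hn t hmem.1.le _ (ht hmem)
      refine ⟨mem_proxNormalCone_of_inner_le (by positivity) (huC t) hy, ?_⟩
      rw [norm_sub_rev]
      exact (norm_sub_le_of_inner_eq_zero (inner_eq_zero_of_hasDerivAt (ht hmem)
        (Eventually.of_forall huC) hy)).trans (le_ciSup hbdd (u t))
    exact ⟨u, g, hgI, hint, fun t _ => huC t, hreg.mono fun _ h => h.1, hreg.mono fun _ h => h.2⟩
  · have h0 : (0 : ℝ) ∈ Icc 0 T := left_mem_Icc.2 hT.le
    have hinit : ∀ w, IsSweepingSol (fun _ => C) f T u₀ w → w 0 = u₀ := fun w hw => by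
      obtain ⟨g, -, hw, -⟩ := hw
      simpa using hw 0 h0
    have hmem : ∀ w, IsSweepingSol (fun _ => C) f T u₀ w → ∀ t ∈ Icc 0 T, w t ∈ C :=
      fun w hw => by
        obtain ⟨g, -, -, hw, -⟩ := hw
        exact hw
    obtain ⟨hu1, hu2⟩ := hCprox.ae_of_isSweepingSol hr hT hM hu
    obtain ⟨hv1, hv2⟩ := hCprox.ae_of_isSweepingSol hr hT hM hv
    exact eqOn_of_hypomonotone hT hflip ((hinit u hu).trans (hinit v hv).symm)
      (hmem u hu) (hmem v hv) hu1 hv1 hu2 hv2
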